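/- arXiv:1507.07730 — 2 statements merged into one kernel-verified Lean document; each statement's English description precedes it below -/
import Mathlib

section
/- Let Δ(x) = (16π²)^{-1} ∫₀^∞ t^{-2} exp(−t m² − |x|²/(4t)) dt be the Euclidean propagator in four dimensions with mass m > 0, for x ∈ ℝ⁴ \ {0}. Then for any multi-index u ∈ ℕ⁴ and any δ ∈ [0,1], |∂^u Δ(x)| ≤ (4/|x|²)^{(|u|+δ)/2 + 1} · (|u|+δ)! / m^δ. -/
noncomputable section
open Real
open scoped BigOperators

/-- Four-dimensional Euclidean space. -/
abbrev E4 := EuclideanSpace ℝ (Fin 4)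

/-- Partial derivative in the `i`-th coordinate direction. -/
def pderiv4 (i : Fin 4) (f : E4 → ℝ) : E4 → ℝ :=
  fun x => fderiv ℝ f x (EuclideanSpace.single i (1 : ℝ))

/-- Multi-index partial derivative `∂^u`. -/
def mderiv4 (u : Fin 4 → ℕ) (f : E4 → ℝ) : E4 → ℝ :=
  (List.finRange 4).foldr (fun i g => (pderiv4 i)^[u i] g) f

/-- The Euclidean propagator in four dimensions with mass `m`, in the
heat-kernel (Schwinger) parametrization. -/
def prop4 (m : ℝ) (x : E4) : ℝ :=
  (16 * π ^ 2)⁻¹ *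
    ∫ t in Set.Ioi (0 : ℝ), t ^ (-2 : ℝ) * Real.exp (-(t * m ^ 2) - ‖x‖ ^ 2 / (4 * t))

/-- real-line iterated derivatives of the complex Gaussian -/
def gk (k : ℕ) (y : ℝ) : ℝ :=
  (iteratedDeriv k (fun z : ℂ => Complex.exp (-z ^ 2 / 2)) (y : ℂ)).re

lemma gk_zero (y : ℝ) : gk 0 y = Real.exp (-y ^ 2 / 2) := by
  have : (-(y : ℂ) ^ 2 / 2) = ((-y ^ 2 / 2 : ℝ) : ℂ) := by push_cast; ring
  simp only [gk, iteratedDeriv_zero]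
  rw [this, Complex.exp_ofReal_re]

lemma gk_hasDerivAt (k : ℕ) (y : ℝ) : HasDerivAt (gk k) (gk (k + 1) y) y := by
  have hs : ContDiff ℂ ⊤ (fun z : ℂ => Complex.exp (-z ^ 2 / 2)) := by fun_prop
  have hd := (hs.differentiable_iteratedDeriv k (WithTop.coe_lt_top (k : ℕ∞))) (y : ℂ)
  have h := hd.hasDerivAt
  rw [← iteratedDeriv_succ] at h
  exact h.real_of_complex

lemma gk_continuous (k : ℕ) : Continuous (gk k) :=
  continuous_iff_continuousAt.2 fun y => (gk_hasDerivAt k y).continuousAt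

lemma gk_bound (k : ℕ) (y R : ℝ) (hR : 0 < R) :
    |gk k y| ≤ (k.factorial : ℝ) * (R⁻¹) ^ k * Real.exp (R ^ 2 / 2 - y ^ 2 / 4) := by
  have hs : Differentiable ℂ (fun z : ℂ => Complex.exp (-z ^ 2 / 2)) := by fun_prop
  refine (Complex.abs_re_le_norm _).trans ?_
  refine (Complex.norm_iteratedDeriv_le_of_forall_mem_sphere_norm_le
    (C := Real.exp (R ^ 2 / 2 - y ^ 2 / 4)) k hR hs.diffContOnCl ?_).trans (le_of_eq ?_)
  · intro z hz
    rw [Complex.norm_exp]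
    apply Real.exp_le_exp.2
    rw [mem_sphere_iff_norm, Complex.norm_eq_sqrt_sq_add_sq] at hz
    have h2 : (z.re - y) ^ 2 + z.im ^ 2 = R ^ 2 := by
      rw [← hz, Real.sq_sqrt (by positivity)]; simp
    have : (-z ^ 2 / 2).re = (z.im ^ 2 - z.re ^ 2) / 2 := by
      have : (-z ^ 2 / 2) = ((1 / 2 : ℝ) : ℂ) * (-(z * z)) := by push_cast; ring
      rw [this, Complex.re_ofReal_mul]
      simp; ring
    rw [this]
    nlinarith [sq_nonneg (z.re - y / 2), sq_nonneg (2 * z.re - y)]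
  · rw [inv_pow, div_eq_mul_inv]; ring

/-- scaled derivatives of the heat kernel -/
def hk (k : ℕ) (t s : ℝ) : ℝ := ((√(2 * t))⁻¹) ^ k * gk k ((√(2 * t))⁻¹ * s)

lemma hk_hasDerivAt (k : ℕ) (t s : ℝ) : HasDerivAt (hk k t) (hk (k + 1) t s) s := by
  have h1 : HasDerivAt (fun s : ℝ => (√(2 * t))⁻¹ * s) ((√(2 * t))⁻¹) s := by
    simpa using (hasDerivAt_id s).const_mul ((√(2 * t))⁻¹)
  have h := ((gk_hasDerivAt k _).comp s h1).const_mul (((√(2 * t))⁻¹) ^ k)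
  refine h.congr_deriv ?_
  simp only [hk]; ring

lemma hk_measurable (k : ℕ) (s : ℝ) : Measurable (fun t => hk k t s) := by
  have := (gk_continuous k).measurable
  unfold hk
  fun_prop

lemma hk_bound (k : ℕ) (t s R : ℝ) (ht : 0 < t) (hR : 0 < R ∨ (k = 0 ∧ R = 0)) :
    |hk k t s| ≤ (k.factorial : ℝ) * (R⁻¹) ^ k * Real.exp (R ^ 2 / (4 * t) - s ^ 2 / (8 * t)) := by
  have hq : 0 < √(2 * t) := Real.sqrt_pos.2 (by positivity)
  have hq2 : √(2 * t) ^ 2 = 2 * t := Real.sq_sqrt (by positivity)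
  rcases hR with hR | ⟨rfl, rfl⟩
  · have h := gk_bound k ((√(2 * t))⁻¹ * s) (R / √(2 * t)) (by positivity)
    rw [hk, abs_mul, abs_of_nonneg (by positivity : 0 ≤ ((√(2 * t))⁻¹) ^ k)]
    refine (mul_le_mul_of_nonneg_left h (by positivity)).trans (le_of_eq ?_)
    have e1 : (R / √(2 * t)) ^ 2 / 2 - ((√(2 * t))⁻¹ * s) ^ 2 / 4
        = R ^ 2 / (4 * t) - s ^ 2 / (8 * t) := by
      rw [div_pow, mul_pow, inv_pow, hq2]; field_simp; ring
    rw [e1, inv_div, div_pow, inv_pow, inv_pow]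
    field_simp
  · simp only [hk, pow_zero, one_mul, gk_zero, Nat.factorial_zero, Nat.cast_one]
    rw [abs_of_pos (Real.exp_pos _)]
    apply Real.exp_le_exp.2
    rw [mul_pow, inv_pow, hq2]
    have : 0 ≤ s ^ 2 / t := by positivity
    have e1 : -((2 * t)⁻¹ * s ^ 2) / 2 = - (s ^ 2 / t) / 4 := by field_simp; ring
    have e2 : s ^ 2 / (8 * t) = (s ^ 2 / t) / 8 := by field_simp
    rw [e1, e2]; simp; linarith

lemma prod_hk_bound (v : Fin 4 → ℕ) (t : ℝ) (x : E4) (R : Fin 4 → ℝ) (ht : 0 < t)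
    (hR : ∀ i, 0 < R i ∨ (v i = 0 ∧ R i = 0)) :
    |∏ i, hk (v i) t (x i)| ≤ (∏ i, (((v i).factorial : ℝ) * ((R i)⁻¹) ^ (v i))) *
      Real.exp ((∑ i, R i ^ 2) / (4 * t) - ‖x‖ ^ 2 / (8 * t)) := by
  rw [Finset.abs_prod]
  refine (Finset.prod_le_prod (fun i _ => abs_nonneg _)
    (fun i _ => hk_bound (v i) t (x i) (R i) ht (hR i))).trans (le_of_eq ?_)
  rw [Finset.prod_mul_distrib, ← Real.exp_sum, EuclideanSpace.norm_sq_eq,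
    Finset.sum_sub_distrib, Finset.sum_div, Finset.sum_div]
  simp

/-- differentiated integrand -/
def Kk (m : ℝ) (v : Fin 4 → ℕ) (x : E4) (t : ℝ) : ℝ :=
  t ^ (-2 : ℝ) * Real.exp (-(t * m ^ 2)) * ∏ i, hk (v i) t (x i)

/-- differentiated propagator -/
def Ik (m : ℝ) (v : Fin 4 → ℕ) (x : E4) : ℝ :=
  (16 * π ^ 2)⁻¹ * ∫ t in Set.Ioi (0 : ℝ), Kk m v x t

lemma prop4_eq (m : ℝ) (x : E4) : prop4 m x = Ik m 0 x := by
  unfold prop4 Ik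
  congr 1
  apply MeasureTheory.setIntegral_congr_fun measurableSet_Ioi
  intro t ht
  have ht : 0 < t := ht
  have hq2 : √(2 * t) ^ 2 = 2 * t := Real.sq_sqrt (by positivity)
  simp only [Kk, hk, gk_zero, Pi.zero_apply, pow_zero, one_mul]
  rw [← Real.exp_sum, mul_assoc, ← Real.exp_add, EuclideanSpace.norm_sq_eq]
  congr 2
  simp only [mul_pow, inv_pow, hq2, Fin.sum_univ_four, Real.norm_eq_abs, sq_abs]
  field_simp
  ring

lemma g_succ_mul (k : ℕ) : ((k + 1 : ℕ) : ℝ) ^ (k + 1) / (((k + 1).factorial : ℝ)) ^ 2 =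
    ((k : ℝ) ^ k / ((k.factorial : ℝ)) ^ 2) * (((k : ℝ) + 1) ^ k / ((k : ℝ) ^ k * (k + 1))) := by
  have h1 : (0 : ℝ) < (k : ℝ) ^ k := by
    rcases Nat.eq_zero_or_pos k with rfl | h
    · simp
    · positivity
  have : (0 : ℝ) < k.factorial := by positivity
  rw [Nat.factorial_succ]; push_cast
  field_simp
  ring

lemma phi_anti : Antitone (fun k : ℕ => (((k : ℝ) + 1) ^ k / ((k : ℝ) ^ k * (k + 1)))) := by
  apply antitone_nat_of_succ_le
  intro k
  have h1 : (0 : ℝ) < (k : ℝ) ^ k := by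
    rcases Nat.eq_zero_or_pos k with rfl | h
    · simp
    · positivity
  rw [div_le_div_iff₀ (by positivity) (by positivity)]
  push_cast
  have h : ((k : ℝ) * (k + 2)) ^ k ≤ ((k + 1) ^ 2) ^ k :=
    pow_le_pow_left₀ (by positivity) (by nlinarith) k
  rw [mul_pow] at h
  calc ((k : ℝ) + 1 + 1) ^ (k + 1) * ((k : ℝ) ^ k * (k + 1))
      = ((k : ℝ) ^ k * (k + 2) ^ k) * ((k + 2) * (k + 1)) := by ring
    _ ≤ ((k + 1) ^ 2) ^ k * ((k + 2) * (k + 1)) := by gcongr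
    _ = _ := by rw [← pow_mul, mul_comm 2 k, pow_mul]; ring

lemma g_mul (a b : ℕ) : ((a + b : ℕ) : ℝ) ^ (a + b) / (((a + b).factorial : ℝ)) ^ 2 ≤
    ((a : ℝ) ^ a / ((a.factorial : ℝ)) ^ 2) * ((b : ℝ) ^ b / ((b.factorial : ℝ)) ^ 2) := by
  induction a with
  | zero => simp
  | succ a ih =>
    have e : a + 1 + b = (a + b) + 1 := by ring
    rw [e, g_succ_mul, g_succ_mul]
    refine (mul_le_mul ih (phi_anti (Nat.le_add_right a b)) (by positivity) (by positivity)).trans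
      (le_of_eq (by ring))

lemma g_mul4 (u : Fin 4 → ℕ) : ((∑ i, u i : ℕ) : ℝ) ^ (∑ i, u i) /
    (((∑ i, u i).factorial : ℝ)) ^ 2 ≤ ∏ i, (((u i : ℕ) : ℝ) ^ (u i) / (((u i).factorial : ℝ)) ^ 2) := by
  rw [Fin.sum_univ_four, Fin.prod_univ_four]
  refine (g_mul _ _).trans ?_
  refine mul_le_mul_of_nonneg_right ?_ (by positivity)
  refine (g_mul _ _).trans ?_
  exact mul_le_mul_of_nonneg_right (g_mul _ _) (by positivity)
lemma int_key (A b : ℝ) (hA : 0 < A) (hb : 0 ≤ b) :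
    MeasureTheory.IntegrableOn (fun t : ℝ => t ^ (-2 : ℝ) * t ^ (-b) * Real.exp (-(A / t)))
      (Set.Ioi 0) ∧
    ∫ t in Set.Ioi (0 : ℝ), t ^ (-2 : ℝ) * t ^ (-b) * Real.exp (-(A / t)) =
      (1 / A) ^ (b + 1) * Real.Gamma (b + 1) := by
  have e : Set.EqOn (fun t : ℝ => (|(-1 : ℝ)| * t ^ ((-1 : ℝ) - 1)) •
      ((fun y : ℝ => y ^ ((b + 1) - 1) * Real.exp (-(A * y))) (t ^ (-1 : ℝ))))
      (fun t : ℝ => t ^ (-2 : ℝ) * t ^ (-b) * Real.exp (-(A / t))) (Set.Ioi 0) := by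
    intro t ht
    have ht : 0 < t := ht
    simp only [smul_eq_mul, abs_neg, abs_one, one_mul, add_sub_cancel_right]
    rw [← Real.rpow_mul ht.le, Real.rpow_neg_one]
    norm_num
    ring_nf
  constructor
  · refine (MeasureTheory.integrableOn_congr_fun e measurableSet_Ioi).1 ?_
    refine (MeasureTheory.integrableOn_Ioi_comp_rpow_iff
      (fun y : ℝ => y ^ ((b + 1) - 1) * Real.exp (-(A * y))) (p := -1) (by norm_num)).2 ?_
    have := integrableOn_rpow_mul_exp_neg_mul_rpow (p := 1) (s := b) (b := A) (by linarith)
      (by norm_num) hA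
    simpa using this
  · rw [← MeasureTheory.setIntegral_congr_fun measurableSet_Ioi e,
      MeasureTheory.integral_comp_rpow_Ioi
        (fun y : ℝ => y ^ ((b + 1) - 1) * Real.exp (-(A * y))) (p := -1) (by norm_num),
      Real.integral_rpow_mul_exp_neg_mul_Ioi (by linarith) hA]

lemma Kk_measurable (m : ℝ) (v : Fin 4 → ℕ) (x : E4) : Measurable (Kk m v x) := by
  have := fun i => hk_measurable (v i) (x i)
  unfold Kk
  have h2 : Measurable (fun t => ∏ i, hk (v i) t (x i)) := Finset.measurable_fun_prod _ (fun i _ => this i)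
  fun_prop

lemma Kk_dom (m : ℝ) (v : Fin 4 → ℕ) (a : ℝ) (ha : 0 < a) : ∃ C : ℝ, ∀ t : ℝ, 0 < t →
    ∀ x : E4, a ≤ ‖x‖ →
    ‖Kk m v x t‖ ≤ C * (t ^ (-2 : ℝ) * t ^ (-(0 : ℝ)) * Real.exp (-((a ^ 2 / 16) / t))) := by
  refine ⟨∏ i, (((v i).factorial : ℝ) * ((a / 8)⁻¹) ^ (v i)), fun t ht x hx => ?_⟩
  have h := prod_hk_bound v t x (fun _ => a / 8) ht (fun i => Or.inl (by positivity))
  rw [Kk, norm_mul, norm_mul, Real.norm_eq_abs, Real.norm_eq_abs, Real.norm_eq_abs,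
    abs_of_pos (Real.exp_pos _), abs_of_pos (by positivity), neg_zero, Real.rpow_zero, mul_one]
  have h1 : Real.exp (-(t * m ^ 2)) ≤ 1 := Real.exp_le_one_iff.2 (by
    have : 0 ≤ t * m ^ 2 := by positivity
    linarith)
  have h2 : Real.exp ((∑ i : Fin 4, (a / 8) ^ 2) / (4 * t) - ‖x‖ ^ 2 / (8 * t)) ≤
      Real.exp (-((a ^ 2 / 16) / t)) := by
    apply Real.exp_le_exp.2
    have h3 : a ^ 2 ≤ ‖x‖ ^ 2 := by gcongr
    have h4 : a ^ 2 / (8 * t) ≤ ‖x‖ ^ 2 / (8 * t) := by gcongr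
    have h5 : (∑ i : Fin 4, (a / 8) ^ 2) / (4 * t) - a ^ 2 / (8 * t) ≤ -((a ^ 2 / 16) / t) := by
      simp only [Finset.sum_const, Finset.card_univ, Fintype.card_fin, nsmul_eq_mul]
      rw [← sub_nonneg]
      have : -((a ^ 2 / 16) / t) - (((4 : ℕ) : ℝ) * (a / 8) ^ 2 / (4 * t) - a ^ 2 / (8 * t))
        = 3 * a ^ 2 / (64 * t) := by push_cast; field_simp; ring
      rw [this]; positivity
    linarith
  calc _ ≤ t ^ (-2 : ℝ) * 1 * ((∏ i, (((v i).factorial : ℝ) * ((a / 8)⁻¹) ^ (v i))) *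
      Real.exp (-((a ^ 2 / 16) / t))) := by
        refine mul_le_mul (by gcongr) (h.trans (by gcongr)) (abs_nonneg _) (by positivity)
    _ = _ := by ring

lemma Kk_hasFDerivAt (m : ℝ) (v : Fin 4 → ℕ) (x : E4) (t : ℝ) :
    HasFDerivAt (fun x => Kk m v x t)
      (∑ i, Kk m (v + Pi.single i 1) x t • (EuclideanSpace.proj (𝕜 := ℝ) i : E4 →L[ℝ] ℝ)) x := by
  have h1 : ∀ i ∈ Finset.univ, HasFDerivAt (fun x : E4 => hk (v i) t (x i))
      (hk (v i + 1) t (x i) • (EuclideanSpace.proj (𝕜 := ℝ) i : E4 →L[ℝ] ℝ)) x := by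
    intro i _
    exact HasDerivAt.comp_hasFDerivAt (h₂ := hk (v i) t)
      (f := fun x : E4 => x i) x (hk_hasDerivAt (v i) t (x i))
      ((EuclideanSpace.proj (𝕜 := ℝ) i : E4 →L[ℝ] ℝ).hasFDerivAt)
  have h := (HasFDerivAt.finsetProd h1).const_mul (t ^ (-2 : ℝ) * Real.exp (-(t * m ^ 2)))
  refine h.congr_fderiv ?_
  rw [Finset.smul_sum]
  refine Finset.sum_congr rfl fun i _ => ?_
  rw [smul_smul, smul_smul]
  congr 1
  rw [Kk, ← Finset.mul_prod_erase _ _ (Finset.mem_univ i)]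
  have : ∏ j ∈ Finset.univ.erase i, hk ((v + Pi.single i 1 : Fin 4 → ℕ) j) t (x j)
      = ∏ j ∈ Finset.univ.erase i, hk (v j) t (x j) :=
    Finset.prod_congr rfl fun j hj => by simp [Finset.ne_of_mem_erase hj]
  rw [this]
  simp
  ring

lemma Kk_integrable (m : ℝ) (v : Fin 4 → ℕ) (x : E4) (hx : x ≠ 0) :
    MeasureTheory.IntegrableOn (Kk m v x) (Set.Ioi 0) := by
  obtain ⟨C, hC⟩ := Kk_dom m v ‖x‖ (norm_pos_iff.2 hx)
  have hx' := norm_pos_iff.2 hx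
  refine MeasureTheory.Integrable.mono' ((int_key (‖x‖ ^ 2 / 16) 0 (by positivity) le_rfl).1.const_mul C)
    (Kk_measurable m v x).aestronglyMeasurable ?_
  refine (MeasureTheory.ae_restrict_iff' measurableSet_Ioi).2 (Filter.Eventually.of_forall ?_)
  intro t ht
  exact hC t ht x le_rfl

lemma Ik_pderiv (m : ℝ) (v : Fin 4 → ℕ) (i : Fin 4) (x : E4) (hx : x ≠ 0) :
    pderiv4 i (Ik m v) x = Ik m (v + Pi.single i 1) x := by
  have hx' := norm_pos_iff.2 hx
  have ha : 0 < ‖x‖ / 2 := by positivity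
  choose C hC using fun i : Fin 4 => Kk_dom m (v + Pi.single i 1) (‖x‖ / 2) ha
  have hs : {y : E4 | ‖x‖ / 2 < ‖y‖} ∈ nhds x :=
    (isOpen_lt continuous_const continuous_norm).mem_nhds (by simpa using hx')
  have hF := hasFDerivAt_integral_of_dominated_of_fderiv_le (𝕜 := ℝ)
    (μ := MeasureTheory.volume.restrict (Set.Ioi (0 : ℝ)))
    (F := fun x t => Kk m v x t)
    (F' := fun x t => ∑ i, Kk m (v + Pi.single i 1) x t •
      (EuclideanSpace.proj (𝕜 := ℝ) i : E4 →L[ℝ] ℝ))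
    (bound := fun t => ∑ i, (C i * (t ^ (-2 : ℝ) * t ^ (-(0 : ℝ)) *
      Real.exp (-(((‖x‖ / 2) ^ 2 / 16) / t)))) * ‖(EuclideanSpace.proj (𝕜 := ℝ) i : E4 →L[ℝ] ℝ)‖)
    hs (Filter.Eventually.of_forall fun y => (Kk_measurable m v y).aestronglyMeasurable)
    (Kk_integrable m v x hx)
    (by
      refine Measurable.aestronglyMeasurable ?_
      refine Finset.measurable_fun_sum _ fun i _ => ?_
      exact (Kk_measurable m _ x).smul_const _)
    (by
      refine (MeasureTheory.ae_restrict_iff' measurableSet_Ioi).2 (Filter.Eventually.of_forall ?_)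
      intro t ht y hy
      refine (norm_sum_le _ _).trans (Finset.sum_le_sum fun i _ => ?_)
      rw [norm_smul]
      exact mul_le_mul_of_nonneg_right (hC i t ht y (le_of_lt hy)) (norm_nonneg _))
    (by
      refine MeasureTheory.integrable_finsetSum _ fun i _ => ?_
      exact ((int_key ((‖x‖ / 2) ^ 2 / 16) 0 (by positivity) le_rfl).1.const_mul (C i)).mul_const _)
    (Filter.Eventually.of_forall fun t y _ => Kk_hasFDerivAt m v y t)
  have hI : HasFDerivAt (Ik m v) _ x := hF.const_mul ((16 * π ^ 2)⁻¹)
  unfold pderiv4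
  rw [hI.fderiv, MeasureTheory.integral_finsetSum]
  · simp only [smul_apply, sum_apply, smul_eq_mul, Ik]
    congr 1
    rw [Finset.sum_eq_single i]
    · rw [integral_smul_const]; simp
    · intro j _ hj
      rw [integral_smul_const]; simp [hj]
    · simp
  · intro j _
    exact (Kk_integrable m _ x hx).smul_const _

lemma pderiv_congr (m : ℝ) (v : Fin 4 → ℕ) (i : Fin 4) (F : E4 → ℝ)
    (hF : ∀ x, x ≠ 0 → F x = Ik m v x) (x : E4) (hx : x ≠ 0) :
    pderiv4 i F x = Ik m (v + Pi.single i 1) x := by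
  rw [← Ik_pderiv m v i x hx]
  unfold pderiv4
  have : F =ᶠ[nhds x] Ik m v := by
    filter_upwards [isOpen_ne.mem_nhds hx] with y hy using hF y hy
  rw [this.fderiv_eq]

lemma pderiv_iter (m : ℝ) (i : Fin 4) (k : ℕ) (v : Fin 4 → ℕ) (F : E4 → ℝ)
    (hF : ∀ x, x ≠ 0 → F x = Ik m v x) :
    ∀ x, x ≠ 0 → (pderiv4 i)^[k] F x = Ik m (v + Pi.single i k) x := by
  induction k with
  | zero => simpa using hF
  | succ k ih =>
    intro x hx
    rw [Function.iterate_succ_apply', pderiv_congr m _ i _ ih x hx, add_assoc, ← Pi.single_add]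

lemma mderiv_eq (m : ℝ) (u : Fin 4 → ℕ) (x : E4) (hx : x ≠ 0) :
    mderiv4 u (prop4 m) x = Ik m u x := by
  have h0 : ∀ x, x ≠ 0 → prop4 m x = Ik m 0 x := fun x _ => prop4_eq m x
  have h := pderiv_iter m 0 (u 0) _ _ (pderiv_iter m 1 (u 1) _ _ (pderiv_iter m 2 (u 2) _ _
    (pderiv_iter m 3 (u 3) _ _ h0))) x hx
  have e : (0 + Pi.single 3 (u 3) + Pi.single 2 (u 2) + Pi.single 1 (u 1) + Pi.single 0 (u 0)
      : Fin 4 → ℕ) = u := by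
    funext j; fin_cases j <;> simp
  rw [e] at h
  rw [← h]
  rfl

lemma comb_bound (u : Fin 4 → ℕ) (r : ℝ) (hr : 0 < r) :
    ∏ i, (((u i).factorial : ℝ) *
      ((r * √((u i : ℝ) / ((∑ i, u i : ℕ) : ℝ)))⁻¹) ^ (u i)) ≤
      ((∑ i, u i).factorial : ℝ) * (r⁻¹) ^ (∑ i, u i) := by
  set n := ∑ i, u i with hn
  have hpow : ∀ k : ℕ, (0 : ℝ) < (k : ℝ) ^ k := fun k => by
    rcases Nat.eq_zero_or_pos k with rfl | h
    · simp
    · positivity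
  have hg := g_mul4 u
  rw [← hn] at hg
  rw [← abs_of_nonneg (show 0 ≤ ∏ i, (((u i).factorial : ℝ) *
      ((r * √((u i : ℝ) / (n : ℝ)))⁻¹) ^ (u i)) from Finset.prod_nonneg fun i _ => by positivity)]
  refine abs_le_of_sq_le_sq ?_ (by positivity)
  have e : ∀ i, (((u i).factorial : ℝ) * ((r * √((u i : ℝ) / (n : ℝ)))⁻¹) ^ (u i)) ^ 2 =
      (r⁻¹ ^ 2 * n) ^ (u i) * ((u i : ℝ) ^ (u i) / ((u i).factorial : ℝ) ^ 2)⁻¹ := by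
    intro i
    have h1 : √((u i : ℝ) / (n : ℝ)) ^ 2 = (u i : ℝ) / n := Real.sq_sqrt (by positivity)
    rw [mul_pow, ← pow_mul, mul_comm (u i) 2, pow_mul, inv_pow, mul_pow, h1, inv_div, mul_inv,
      inv_div, mul_pow, mul_pow, inv_pow, div_pow]
    ring
  rw [← Finset.prod_pow, Finset.prod_congr rfl fun i _ => e i, Finset.prod_mul_distrib,
    Finset.prod_pow_eq_pow_sum, ← hn, Finset.prod_inv_distrib]
  have hg0 : (0 : ℝ) < (n : ℝ) ^ n / (n.factorial : ℝ) ^ 2 := by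
    have := hpow n
    positivity
  calc _ ≤ (r⁻¹ ^ 2 * n) ^ n * ((n : ℝ) ^ n / (n.factorial : ℝ) ^ 2)⁻¹ := by
        gcongr
    _ = _ := by
        have := hpow n
        rw [inv_div, mul_pow, mul_pow, ← pow_mul, ← pow_mul, mul_comm 2 n]
        field_simp
lemma rpow_le_exp (s a : ℝ) (hs : 0 < s) (ha0 : 0 ≤ a) (ha1 : a ≤ 1) : s ^ a ≤ Real.exp s := by
  rcases le_total s 1 with h | h
  · exact (Real.rpow_le_one hs.le h ha0).trans (Real.one_le_exp hs.le)
  · have h1 : s ^ a ≤ s ^ (1 : ℝ) := Real.rpow_le_rpow_of_exponent_le h ha1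
    rw [Real.rpow_one] at h1
    linarith [Real.add_one_le_exp s]

lemma exp_mass (t m δ : ℝ) (ht : 0 < t) (hm : 0 < m) (h0 : 0 ≤ δ) (h1 : δ ≤ 1) :
    Real.exp (-(t * m ^ 2)) ≤ t ^ (-(δ / 2)) * (m ^ δ)⁻¹ := by
  have h := rpow_le_exp (t * m ^ 2) (δ / 2) (by positivity) (by linarith) (by linarith)
  have e : (t * m ^ 2) ^ (δ / 2) = t ^ (δ / 2) * m ^ δ := by
    rw [Real.mul_rpow ht.le (by positivity), ← Real.rpow_natCast, ← Real.rpow_mul hm.le]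
    congr 2; push_cast; ring
  rw [e] at h
  rw [Real.exp_neg, Real.rpow_neg ht.le, ← mul_inv]
  exact inv_anti₀ (by positivity) h

lemma gamma_upper (b : ℝ) (h0 : 0 ≤ b) (h1 : b ≤ 1) : Real.Gamma (b + 1) ≤ 2 := by
  have h2 : Real.Gamma (b + 1 + 1) = (b + 1) * Real.Gamma (b + 1) :=
    Real.Gamma_add_one (by positivity)
  have h3 : Real.Gamma (b + 1 + 1) ≤ Real.Gamma 3 :=
    Real.Gamma_strictMonoOn_Ici.monotoneOn (by simp; linarith) (by simp; norm_num) (by linarith)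
  have h4 : Real.Gamma 3 = 2 := by
    have := Real.Gamma_nat_eq_factorial 2
    norm_num at this ⊢
  have h5 : 0 < Real.Gamma (b + 1) := Real.Gamma_pos_of_pos (by positivity)
  nlinarith

lemma gamma_lower (n : ℕ) (δ : ℝ) (h0 : 0 ≤ δ) (h1 : δ ≤ 1) :
    (n.factorial : ℝ) / 2 ≤ Real.Gamma ((n : ℝ) + δ + 1) := by
  rcases Nat.eq_zero_or_pos n with rfl | hn
  · have h2 : Real.Gamma (δ + 1 + 1) = (δ + 1) * Real.Gamma (δ + 1) :=
      Real.Gamma_add_one (by positivity)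
    have h3 : Real.Gamma 2 ≤ Real.Gamma (δ + 1 + 1) :=
      Real.Gamma_strictMonoOn_Ici.monotoneOn (by simp) (by simp; linarith) (by linarith)
    rw [Real.Gamma_two] at h3
    have h5 : 0 < Real.Gamma (δ + 1) := Real.Gamma_pos_of_pos (by positivity)
    simp
    nlinarith
  · have hn' : (1 : ℝ) ≤ n := by exact_mod_cast hn
    have h3 : Real.Gamma ((n : ℝ) + 1) ≤ Real.Gamma ((n : ℝ) + δ + 1) :=
      Real.Gamma_strictMonoOn_Ici.monotoneOn (by simp; linarith) (by simp; linarith) (by linarith)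
    rw [Real.Gamma_nat_eq_factorial] at h3
    have : (0 : ℝ) < n.factorial := by positivity
    linarith

lemma Kk_final (m : ℝ) (hm : 0 < m) (u : Fin 4 → ℕ) (δ : ℝ) (hδ0 : 0 ≤ δ) (hδ1 : δ ≤ 1)
    (x : E4) (hx : x ≠ 0) (t : ℝ) (ht : 0 < t) :
    ‖Kk m u x t‖ ≤ (((∑ i, u i).factorial : ℝ) * ((‖x‖ / 2)⁻¹) ^ (∑ i, u i) * (m ^ δ)⁻¹) *
      (t ^ (-2 : ℝ) * t ^ (-(δ / 2)) * Real.exp (-((‖x‖ ^ 2 / 16) / t))) := by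
  have hx' := norm_pos_iff.2 hx
  have hc := comb_bound u (‖x‖ / 2) (by positivity)
  have hp := prod_hk_bound u t x
    (fun i => ‖x‖ / 2 * √((u i : ℝ) / ((∑ i, u i : ℕ) : ℝ))) ht (by
      intro i
      rcases Nat.eq_zero_or_pos (u i) with h | h
      · right; simp [h]
      · left
        have : 0 < ∑ i, u i := lt_of_lt_of_le h
          (Finset.single_le_sum (fun j _ => Nat.zero_le (u j)) (Finset.mem_univ i))
        have h1 : (0 : ℝ) < u i := by exact_mod_cast h
        have h2 : (0 : ℝ) < ((∑ i, u i : ℕ) : ℝ) := by exact_mod_cast this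
        exact mul_pos (by positivity) (Real.sqrt_pos.2 (div_pos h1 h2)))
  have hsum : ∑ i, (‖x‖ / 2 * √((u i : ℝ) / ((∑ i, u i : ℕ) : ℝ))) ^ 2 ≤ ‖x‖ ^ 2 / 4 := by
    have e : ∀ i, (‖x‖ / 2 * √((u i : ℝ) / ((∑ i, u i : ℕ) : ℝ))) ^ 2 =
        ‖x‖ ^ 2 / 4 * ((u i : ℝ) / ((∑ i, u i : ℕ) : ℝ)) := fun i => by
      rw [mul_pow, Real.sq_sqrt (by positivity)]; ring
    rw [Finset.sum_congr rfl fun i _ => e i, ← Finset.mul_sum, ← Finset.sum_div, ← Nat.cast_sum]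
    exact mul_le_of_le_one_right (by positivity) (div_self_le_one _)
  have hexp : Real.exp ((∑ i, (‖x‖ / 2 * √((u i : ℝ) / ((∑ i, u i : ℕ) : ℝ))) ^ 2) / (4 * t)
      - ‖x‖ ^ 2 / (8 * t)) ≤ Real.exp (-((‖x‖ ^ 2 / 16) / t)) := by
    apply Real.exp_le_exp.2
    have h1 : (∑ i, (‖x‖ / 2 * √((u i : ℝ) / ((∑ i, u i : ℕ) : ℝ))) ^ 2) / (4 * t)
      ≤ (‖x‖ ^ 2 / 4) / (4 * t) := by gcongr
    have h2 : (‖x‖ ^ 2 / 4) / (4 * t) - ‖x‖ ^ 2 / (8 * t) = -((‖x‖ ^ 2 / 16) / t) := by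
      field_simp; ring
    linarith
  have hm' := exp_mass t m δ ht hm hδ0 hδ1
  rw [Kk, norm_mul, norm_mul, Real.norm_eq_abs, Real.norm_eq_abs, Real.norm_eq_abs,
    abs_of_pos (Real.exp_pos _), abs_of_pos (by positivity)]
  calc _ ≤ t ^ (-2 : ℝ) * (t ^ (-(δ / 2)) * (m ^ δ)⁻¹) *
      ((((∑ i, u i).factorial : ℝ) * ((‖x‖ / 2)⁻¹) ^ (∑ i, u i)) *
        Real.exp (-((‖x‖ ^ 2 / 16) / t))) := by
        refine mul_le_mul (by gcongr) (hp.trans ?_) (abs_nonneg _) (by positivity)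
        exact mul_le_mul hc hexp (Real.exp_pos _).le (by positivity)
    _ = _ := by ring

/-- Propagator derivative bound: `|∂^u Δ(x)| ≤ (4/|x|²)^{(|u|+δ)/2+1}·(|u|+δ)!/m^δ`,
with `(|u|+δ)!` interpreted as `Γ(|u|+δ+1)`. -/
theorem propagator_deriv_bound (m : ℝ) (hm : 0 < m) (u : Fin 4 → ℕ) (δ : ℝ)
    (hδ0 : 0 ≤ δ) (hδ1 : δ ≤ 1) (x : E4) (hx : x ≠ 0) :
    |mderiv4 u (prop4 m) x| ≤
      (4 / ‖x‖ ^ 2) ^ ((((∑ i, u i : ℕ) : ℝ) + δ) / 2 + 1) *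
        Real.Gamma (((∑ i, u i : ℕ) : ℝ) + δ + 1) / m ^ δ := by
  have hx' := norm_pos_iff.2 hx
  rw [mderiv_eq m u x hx]
  obtain ⟨hi, hv⟩ := int_key (‖x‖ ^ 2 / 16) (δ / 2) (by positivity) (by linarith)
  have hb := MeasureTheory.norm_integral_le_of_norm_le
    (μ := MeasureTheory.volume.restrict (Set.Ioi (0 : ℝ))) (f := Kk m u x)
    (hi.const_mul (((∑ i, u i).factorial : ℝ) * ((‖x‖ / 2)⁻¹) ^ (∑ i, u i) * (m ^ δ)⁻¹))
    ((MeasureTheory.ae_restrict_iff' measurableSet_Ioi).2 (Filter.Eventually.of_forall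
      fun t ht => Kk_final m hm u δ hδ0 hδ1 x hx t ht))
  rw [MeasureTheory.integral_const_mul, hv] at hb
  generalize (∑ i, u i) = n at *
  have hlow := gamma_lower n δ hδ0 hδ1
  have hup := gamma_upper (δ / 2) (by linarith) (by linarith)
  have hG : 0 < Real.Gamma (δ / 2 + 1) := Real.Gamma_pos_of_pos (by positivity)
  have e1 : (1 / (‖x‖ ^ 2 / 16)) ^ (δ / 2 + 1) =
      (4 : ℝ) ^ (δ / 2 + 1) * (4 / ‖x‖ ^ 2) ^ (δ / 2 + 1) := by
    rw [← Real.mul_rpow (by norm_num) (by positivity)]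
    congr 1; field_simp; norm_num
  have e2 : (4 / ‖x‖ ^ 2) ^ (((n : ℝ) + δ) / 2 + 1) =
      ((‖x‖ / 2)⁻¹) ^ n * (4 / ‖x‖ ^ 2) ^ (δ / 2 + 1) := by
    have : ((n : ℝ) + δ) / 2 + 1 = (n : ℝ) / 2 + (δ / 2 + 1) := by ring
    rw [this, Real.rpow_add (by positivity)]
    congr 1
    have h4 : 4 / ‖x‖ ^ 2 = ((‖x‖ / 2)⁻¹) ^ (2 : ℝ) := by
      rw [Real.rpow_two]; field_simp; norm_num
    rw [h4, ← Real.rpow_mul (by positivity), ← Real.rpow_natCast]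
    congr 1; ring
  have h16 : (4 : ℝ) ^ (δ / 2 + 1) ≤ 16 := by
    calc (4 : ℝ) ^ (δ / 2 + 1) ≤ (4 : ℝ) ^ (2 : ℝ) :=
          Real.rpow_le_rpow_of_exponent_le (by norm_num) (by linarith)
      _ = 16 := by rw [Real.rpow_two]; norm_num
  have hpi : (16 * π ^ 2)⁻¹ ≤ (64 : ℝ)⁻¹ :=
    inv_anti₀ (by norm_num) (by nlinarith [Real.pi_gt_three])
  rw [Ik, abs_mul, abs_of_pos (by positivity : (0 : ℝ) < (16 * π ^ 2)⁻¹), ← Real.norm_eq_abs, e2]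
  rw [e1] at hb
  set P := (4 / ‖x‖ ^ 2) ^ (δ / 2 + 1) with hP
  have hP0 : 0 < P := by positivity
  set Q := ((‖x‖ / 2)⁻¹) ^ n with hQ
  have hQ0 : 0 < Q := by positivity
  have hM : 0 < (m ^ δ)⁻¹ := by positivity
  calc _ ≤ (64 : ℝ)⁻¹ * ((n.factorial : ℝ) * Q * (m ^ δ)⁻¹ * (16 * P * 2)) := by
        refine mul_le_mul hpi (hb.trans ?_) (norm_nonneg _) (by norm_num)
        gcongr
    _ = Q * P * ((n.factorial : ℝ) / 2) * (m ^ δ)⁻¹ := by ring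
    _ ≤ Q * P * Real.Gamma ((n : ℝ) + δ + 1) * (m ^ δ)⁻¹ := by gcongr
    _ = _ := by rw [div_eq_mul_inv]

end
end

section
/- For any t > 0, any multi-index u ∈ ℕ⁴, and any x ∈ ℝ⁴, the Gaussian satisfies the derivative bound |∂^u exp(−|x|²/(4t))| ≤ 2 · t^{−|u|/2} · √(|u|!) · 2^{−|u|/2} · exp(−|x|²/(8t)). -/
noncomputable section
open scoped BigOperators

lemma gdb_gamma : Real.Gamma (1 / 4 + 1) ≤ 1 := by
  have h := Real.convexOn_Gamma.2 (show (1:ℝ) ∈ Set.Ioi (0:ℝ) by simp)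
    (show (2:ℝ) ∈ Set.Ioi (0:ℝ) by simp)
    (show (0:ℝ) ≤ 3/4 by norm_num) (show (0:ℝ) ≤ 1/4 by norm_num) (by norm_num)
  simp only [smul_eq_mul, Real.Gamma_one, Real.Gamma_two] at h
  norm_num at h ⊢
  exact h

lemma gdb_quartic (s A : ℝ) (hs : 0 < s) (hA : 0 ≤ A) :
    ∫ v in (0:ℝ)..A, Real.exp (-(v / s) ^ 4) ≤ s := by
  have hb : 0 < (s ^ 4)⁻¹ := by positivity
  have e1 : ∀ v : ℝ, Real.exp (-(v / s) ^ 4) = v ^ (0:ℝ) * Real.exp (-(s ^ 4)⁻¹ * v ^ (4:ℝ)) := by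
    intro v
    rw [Real.rpow_zero, one_mul, show (4:ℝ) = ((4:ℕ):ℝ) by norm_num, Real.rpow_natCast]
    congr 1
    field_simp
  have h1 := integral_exp_neg_mul_rpow (p := 4) (b := (s ^ 4)⁻¹) (by norm_num) hb
  have hi := integrableOn_rpow_mul_exp_neg_mul_rpow (p := 4) (s := 0) (b := (s ^ 4)⁻¹)
    (by norm_num) (by norm_num) hb
  have h3 : ((s ^ 4)⁻¹ : ℝ) ^ ((-1 : ℝ) / 4) = s := by
    rw [← Real.rpow_natCast, ← Real.rpow_neg hs.le, ← Real.rpow_mul hs.le]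
    norm_num
  rw [h3] at h1
  rw [intervalIntegral.integral_of_le hA]
  simp_rw [e1]
  calc _ ≤ ∫ v in Set.Ioi (0:ℝ), v ^ (0:ℝ) * Real.exp (-(s ^ 4)⁻¹ * v ^ (4:ℝ)) := by
        apply MeasureTheory.setIntegral_mono_set hi
        · filter_upwards with v
          rw [Real.rpow_zero]; simp only [Pi.zero_apply]; positivity
        · exact Set.Ioc_subset_Ioi_self.eventuallyLE
    _ = s * Real.Gamma (1 / 4 + 1) := by simpa using h1
    _ ≤ s * 1 := by gcongr; exact gdb_gamma
    _ = s := mul_one s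

lemma gdb_sin (w : ℝ) (h0 : 0 ≤ w) (h1 : w ≤ Real.pi / 4) : 2 * (2 * w / Real.pi) ^ 2 ≤ Real.sin w ^ 2 := by
  have hpi := Real.pi_pos
  have h := strictConcaveOn_sin_Icc.concaveOn.2
    (show (0:ℝ) ∈ Set.Icc 0 Real.pi from ⟨le_rfl, hpi.le⟩)
    (show Real.pi / 4 ∈ Set.Icc 0 Real.pi from ⟨by positivity, by linarith⟩)
    (show 0 ≤ 1 - 4 * w / Real.pi by rw [sub_nonneg, div_le_one hpi]; linarith)
    (show 0 ≤ 4 * w / Real.pi by positivity) (by ring)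
  simp only [smul_eq_mul, Real.sin_zero, Real.sin_pi_div_four, mul_zero, zero_add] at h
  rw [show 4 * w / Real.pi * (Real.pi / 4) = w by field_simp] at h
  have h2 : (0:ℝ) ≤ 4 * w / Real.pi * (√2 / 2) := by positivity
  have h3 := pow_le_pow_left₀ h2 h 2
  have h4 : (√2 : ℝ) ^ 2 = 2 := Real.sq_sqrt (by norm_num)
  calc _ = (4 * w / Real.pi * (√2 / 2)) ^ 2 := by
        rw [mul_pow, div_pow (√2 : ℝ), h4]; ring
    _ ≤ _ := h3

lemma gdb_cosdiff (θ α : ℝ) (hθ : 0 ≤ θ) (hθ' : θ ≤ Real.pi) (hα : 0 ≤ α) (hα' : α ≤ Real.pi) :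
    (2 * Real.sin ((θ - α) / 2) ^ 2) ^ 2 ≤ (Real.cos θ - Real.cos α) ^ 2 := by
  have hp : Real.sin ((θ - α) / 2) ^ 2 ≤ Real.sin ((θ + α) / 2) ^ 2 := by
    have e : Real.sin ((θ + α) / 2) ^ 2 - Real.sin ((θ - α) / 2) ^ 2 = Real.sin θ * Real.sin α := by
      have e1 : θ = (θ + α) / 2 + (θ - α) / 2 := by ring
      have e2 : α = (θ + α) / 2 - (θ - α) / 2 := by ring
      conv_rhs => rw [e1]
      conv_rhs => rw [show Real.sin α = Real.sin ((θ + α) / 2 - (θ - α) / 2) by rw [← e2]]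
      rw [Real.sin_add, Real.sin_sub]
      have a1 := Real.sin_sq_add_cos_sq ((θ + α) / 2)
      have a2 := Real.sin_sq_add_cos_sq ((θ - α) / 2)
      generalize Real.sin ((θ + α) / 2) = A at *
      generalize Real.cos ((θ + α) / 2) = B at *
      generalize Real.sin ((θ - α) / 2) = C at *
      generalize Real.cos ((θ - α) / 2) = D at *
      linear_combination C ^ 2 * a1 - A ^ 2 * a2
    have := mul_nonneg (Real.sin_nonneg_of_nonneg_of_le_pi hθ hθ')
      (Real.sin_nonneg_of_nonneg_of_le_pi hα hα')
    linarith
  rw [Real.cos_sub_cos]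
  have := sq_nonneg (Real.sin ((θ - α) / 2))
  nlinarith [mul_le_mul_of_nonneg_left hp this]

lemma gdb_J1 (m α : ℝ) (hm : 0 < m) (hα : 0 ≤ α) (hα' : α ≤ Real.pi / 2) :
    ∫ θ in (0:ℝ)..Real.pi, Real.exp (-(m ^ 4 * (Real.cos θ - Real.cos α) ^ 2)) ≤
      Real.pi * (1 / 2 + √2 / 2) / m := by
  have hpi := Real.pi_pos
  have hc : Continuous fun θ : ℝ => Real.exp (-(m ^ 4 * (Real.cos θ - Real.cos α) ^ 2)) := by
    fun_prop
  rw [← intervalIntegral.integral_add_adjacent_intervals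
    (hc.intervalIntegrable 0 α) (hc.intervalIntegrable α Real.pi)]
  have A : ∫ θ in (0:ℝ)..α, Real.exp (-(m ^ 4 * (Real.cos θ - Real.cos α) ^ 2)) ≤
      Real.pi / 2 / m := by
    have hs : 0 < Real.pi / 2 / m := by positivity
    refine le_trans ?_ (gdb_quartic (Real.pi / 2 / m) α hs hα)
    have := intervalIntegral.integral_comp_sub_left (a := 0) (b := α)
      (fun v => Real.exp (-(v / (Real.pi / 2 / m)) ^ 4)) α
    rw [sub_self, sub_zero] at this
    rw [← this]
    apply intervalIntegral.integral_mono_on hα (hc.intervalIntegrable _ _)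
    · exact Continuous.intervalIntegrable (by fun_prop) _ _
    intro θ hθ
    apply Real.exp_le_exp.2
    apply neg_le_neg
    have h1 := gdb_cosdiff θ α hθ.1 (by linarith [hθ.2]) hα (by linarith)
    have h2 := gdb_sin ((α - θ) / 2) (by linarith [hθ.2]) (by linarith [hθ.1])
    rw [show (θ - α) / 2 = -((α - θ) / 2) by ring, Real.sin_neg, neg_sq] at h1
    have h3 := pow_le_pow_left₀ (by positivity) (mul_le_mul_of_nonneg_left h2 zero_le_two) 2
    have h4 := mul_le_mul_of_nonneg_left (h3.trans h1) (by positivity : 0 ≤ m ^ 4)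
    refine le_trans (le_of_eq ?_) h4
    field_simp
  have B : ∫ θ in α..Real.pi, Real.exp (-(m ^ 4 * (Real.cos θ - Real.cos α) ^ 2)) ≤
      Real.pi * (√2 / 2) / m := by
    have hs : 0 < Real.pi * (√2 / 2) / m := by positivity
    refine le_trans ?_ (gdb_quartic (Real.pi * (√2 / 2) / m) (Real.pi - α) hs (by linarith))
    have := intervalIntegral.integral_comp_sub_right (a := α) (b := Real.pi)
      (fun v => Real.exp (-(v / (Real.pi * (√2 / 2) / m)) ^ 4)) α
    rw [sub_self] at this
    rw [← this]
    apply intervalIntegral.integral_mono_on (by linarith) (hc.intervalIntegrable _ _)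
    · exact Continuous.intervalIntegrable (by fun_prop) _ _
    intro θ hθ
    apply Real.exp_le_exp.2
    apply neg_le_neg
    have h1 := gdb_cosdiff θ α (by linarith [hθ.1]) hθ.2 hα (by linarith)
    have h2 := Real.mul_le_sin (x := (θ - α) / 2) (by linarith [hθ.1]) (by linarith [hθ.2])
    have h0 : 0 ≤ 2 / Real.pi * ((θ - α) / 2) :=
      mul_nonneg (by positivity) (by linarith [hθ.1])
    have h3 := pow_le_pow_left₀ (by positivity)
      (mul_le_mul_of_nonneg_left (pow_le_pow_left₀ h0 h2 2) zero_le_two) 2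
    have h4 := mul_le_mul_of_nonneg_left (h3.trans h1) (by positivity : 0 ≤ m ^ 4)
    refine le_trans (le_of_eq ?_) h4
    have h5 : (√2 : ℝ) ^ 4 = 4 := by
      rw [show 4 = 2 * 2 by norm_num, pow_mul, Real.sq_sqrt (by norm_num)]; norm_num
    rw [div_pow, div_pow, mul_pow, div_pow, h5]
    field_simp
    ring
  calc _ ≤ _ := add_le_add A B
    _ = _ := by ring

lemma gdb_J2 (m a : ℝ) (hm : 0 < m) (ha : 0 ≤ a) :
    ∫ θ in (0:ℝ)..Real.pi, Real.exp (-(m ^ 4 * (Real.cos θ - a) ^ 2)) ≤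
      Real.pi * (1 / 2 + √2 / 2) / m := by
  by_cases h1 : a ≤ 1
  · have := gdb_J1 m (Real.arccos a) hm (Real.arccos_nonneg a) (Real.arccos_le_pi_div_two.2 ha)
    rwa [Real.cos_arccos (by linarith) h1] at this
  · push Not at h1
    have := gdb_J1 m 0 hm le_rfl (by positivity)
    refine le_trans ?_ this
    apply intervalIntegral.integral_mono_on Real.pi_pos.le
    · exact Continuous.intervalIntegrable (by fun_prop) _ _
    · exact Continuous.intervalIntegrable (by fun_prop) _ _
    intro θ _
    apply Real.exp_le_exp.2
    apply neg_le_neg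
    rw [Real.cos_zero]
    gcongr ?_ * ?_
    have := Real.cos_le_one θ
    nlinarith

lemma gdb_J3 (m a : ℝ) (hm : 0 < m) :
    ∫ θ in (0:ℝ)..Real.pi, Real.exp (-(m ^ 4 * (Real.cos θ - a) ^ 2)) ≤
      Real.pi * (1 / 2 + √2 / 2) / m := by
  rcases le_total 0 a with ha | ha
  · exact gdb_J2 m a hm ha
  · have := gdb_J2 m (-a) hm (by linarith)
    have h2 := intervalIntegral.integral_comp_sub_left (a := 0) (b := Real.pi)
      (fun θ => Real.exp (-(m ^ 4 * (Real.cos θ - a) ^ 2))) Real.pi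
    rw [sub_self, sub_zero] at h2
    rw [← h2]
    refine le_trans (le_of_eq ?_) this
    congr 1; ext θ
    rw [Real.cos_pi_sub]
    ring_nf

lemma gdb_J (m a : ℝ) (hm : 0 < m) :
    (2 * Real.pi)⁻¹ * ∫ θ in (0:ℝ)..2 * Real.pi, Real.exp (-(m ^ 4 * (Real.cos θ + a) ^ 2)) ≤
      (1 / 2 + √2 / 2) / m := by
  have hpi := Real.pi_pos
  have h := gdb_J3 m (-a) hm
  simp only [sub_neg_eq_add] at h
  have hc : Continuous fun θ : ℝ => Real.exp (-(m ^ 4 * (Real.cos θ + a) ^ 2)) := by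
    fun_prop
  rw [← intervalIntegral.integral_add_adjacent_intervals
    (hc.intervalIntegrable 0 Real.pi) (hc.intervalIntegrable Real.pi (2 * Real.pi))]
  have h2 := intervalIntegral.integral_comp_sub_left (a := 0) (b := Real.pi)
      (fun θ => Real.exp (-(m ^ 4 * (Real.cos θ + a) ^ 2))) (2 * Real.pi)
  rw [sub_zero, show 2 * Real.pi - Real.pi = Real.pi by ring] at h2
  simp only [Real.cos_two_pi_sub] at h2
  rw [← h2]
  rw [inv_mul_le_iff₀ (by positivity)]
  calc _ ≤ _ := add_le_add h h
    _ = _ := by ring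

lemma gdb_stirling (n : ℕ) (hn : n ≠ 0) :
    (n.factorial : ℝ) * Real.exp n ≤ Real.exp 1 * √n * (n:ℝ) ^ n := by
  obtain ⟨k, rfl⟩ := Nat.exists_eq_succ_of_ne_zero hn
  have h := Stirling.stirlingSeq'_antitone (Nat.zero_le k)
  simp only [Function.comp, Nat.succ_eq_add_one, zero_add, Stirling.stirlingSeq_one] at h
  rw [Stirling.stirlingSeq] at h
  simp only [Nat.succ_eq_add_one] at *
  generalize k + 1 = n at *
  have hn' : (0:ℝ) < n := by positivity
  rw [div_le_div_iff₀ (by positivity) (by positivity), Real.sqrt_mul (by norm_num), div_pow,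
    ← Real.exp_nat_mul, mul_one] at h
  have h2 : (0:ℝ) < √2 := by positivity
  have h3 := Real.exp_pos n
  rw [show Real.exp 1 * (√2 * √(n:ℝ) * ((n:ℝ) ^ n / Real.exp n)) =
    (Real.exp 1 * √n * (n:ℝ) ^ n) / Real.exp n * √2 by ring] at h
  have h4 := le_of_mul_le_mul_right h h2
  rwa [le_div_iff₀ h3] at h4

lemma gdb_const (n : ℕ) (hn : n ≠ 0) (a : ℝ) :
    (n.factorial : ℝ) * (((2 * Real.pi)⁻¹ * ∫ θ in (0:ℝ)..2 * Real.pi,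
      Real.exp (n / 2) * Real.exp (-(n * (Real.cos θ + a) ^ 2))) * (√n)⁻¹ ^ n) ≤
      2 * √(n.factorial) := by
  have hn' : (0:ℝ) < n := by positivity
  set m : ℝ := √(√n) with hmdef
  have hm : 0 < m := by positivity
  have hm2 : m ^ 2 = √n := Real.sq_sqrt (by positivity)
  have hm4 : m ^ 4 = n := by
    rw [show 4 = 2 * 2 by norm_num, pow_mul, hm2, Real.sq_sqrt hn'.le]
  have hJ := gdb_J m a hm
  rw [hm4] at hJ
  rw [intervalIntegral.integral_const_mul]
  set J := (2 * Real.pi)⁻¹ * ∫ θ in (0:ℝ)..2 * Real.pi, Real.exp (-(n * (Real.cos θ + a) ^ 2))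
  have hs := gdb_stirling n hn
  set X : ℝ := n.factorial * Real.exp (n / 2) * (√n)⁻¹ ^ n with hX
  have hX0 : 0 ≤ X := by positivity
  have hX2 : X ≤ √(n.factorial) * √(Real.exp 1) * m := by
    apply le_of_sq_le_sq _ (by positivity)
    rw [mul_pow (_ * _) m, mul_pow (√_) (√_), Real.sq_sqrt (by positivity), Real.sq_sqrt (by positivity), hm2]
    have e : X ^ 2 = n.factorial * (n.factorial * Real.exp n) / (n:ℝ) ^ n := by
      rw [hX, mul_pow, mul_pow, ← Real.exp_nat_mul, ← pow_mul, mul_comm n 2, pow_mul, inv_pow,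
        Real.sq_sqrt hn'.le, inv_pow]
      rw [show ((2:ℕ):ℝ) * (n / 2) = n by push_cast; ring]
      ring
    rw [e, div_le_iff₀ (by positivity)]
    calc _ ≤ (n.factorial:ℝ) * (Real.exp 1 * √n * (n:ℝ) ^ n) := by gcongr
      _ = _ := by ring
  have hk : √(Real.exp 1) * (1 / 2 + √2 / 2) ≤ 2 := by
    have h1 : √(Real.exp 1) ≤ 1.65 := by
      rw [Real.sqrt_le_left (by norm_num)]
      have := Real.exp_one_lt_d9
      norm_num at *; linarith
    have h2 : √(2:ℝ) ≤ 1.4143 := by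
      rw [Real.sqrt_le_left (by norm_num)]; norm_num
    have := Real.sqrt_nonneg 2
    calc √(Real.exp 1) * (1 / 2 + √2 / 2) ≤ 1.65 * (1 / 2 + 1.4143 / 2) := by gcongr
      _ ≤ 2 := by norm_num
  calc _ = X * J := by rw [hX]; ring
    _ ≤ X * ((1 / 2 + √2 / 2) / m) := by gcongr
    _ ≤ (√(n.factorial) * √(Real.exp 1) * m) * ((1 / 2 + √2 / 2) / m) := by gcongr
    _ = √(n.factorial) * (√(Real.exp 1) * (1 / 2 + √2 / 2)) := by field_simp
    _ ≤ √(n.factorial) * 2 := by gcongr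
    _ = _ := mul_comm _ _

def gdbF (t : ℝ) (z : ℂ) : ℂ := Complex.exp (-z ^ 2 / (4 * t))

def gdbG (t : ℝ) (n : ℕ) (y : ℝ) : ℝ := (iteratedDeriv n (gdbF t) (y : ℂ)).re

lemma gdbF_contDiff (t : ℝ) : ContDiff ℂ ⊤ (gdbF t) := by
  unfold gdbF; fun_prop

lemma gdbG_hasDerivAt (t : ℝ) (n : ℕ) (y : ℝ) : HasDerivAt (gdbG t n) (gdbG t (n + 1) y) y := by
  unfold gdbG
  apply HasDerivAt.real_of_complex
  rw [iteratedDeriv_succ]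
  apply DifferentiableAt.hasDerivAt
  exact ((gdbF_contDiff t).differentiable_iteratedDeriv n (by exact_mod_cast WithTop.coe_lt_top _)) _

lemma gdbG_zero (t y : ℝ) : gdbG t 0 y = Real.exp (-y ^ 2 / (4 * t)) := by
  simp only [gdbG, gdbF, iteratedDeriv_zero]
  rw [← Complex.exp_ofReal_re]
  push_cast; rfl

lemma gdbG_one (t y : ℝ) : gdbG t 1 y = -(y / (2 * t)) * Real.exp (-y ^ 2 / (4 * t)) := by
  have h1 := gdbG_hasDerivAt t 0 y
  have h2 : HasDerivAt (gdbG t 0) (Real.exp (-y ^ 2 / (4 * t)) * (-(2 * y) / (4 * t))) y := by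
    rw [funext (gdbG_zero t)]
    apply HasDerivAt.exp
    apply HasDerivAt.div_const
    have h3 := (hasDerivAt_pow 2 y).fun_neg
    simpa using h3
  rw [zero_add] at h1
  rw [h1.unique h2]
  by_cases ht : t = 0
  · subst ht; simp
  · field_simp; ring

lemma gdbF_norm (t x θ : ℝ) (n : ℕ) (hn : n ≠ 0) (ht : 0 < t) :
    ‖gdbF t (circleMap x (√(2 * t) * √n) θ)‖ =
      Real.exp (-x ^ 2 / (8 * t)) * (Real.exp (n / 2) *
        Real.exp (-(n * (Real.cos θ + x / (2 * (√(2 * t) * √n))) ^ 2))) := by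
  have hn' : (0:ℝ) < n := by positivity
  set R := √(2 * t) * √n with hR
  have hR0 : 0 < R := by positivity
  have hR2 : R ^ 2 = 2 * t * n := by
    rw [hR, mul_pow, Real.sq_sqrt (by positivity), Real.sq_sqrt hn'.le]
  rw [gdbF, Complex.norm_exp, ← Real.exp_add, ← Real.exp_add]
  congr 1
  have e : (-(circleMap x R θ) ^ 2 / (4 * (t:ℂ))) =
      ((-((x + R * Real.cos θ) ^ 2 - (R * Real.sin θ) ^ 2) / (4 * t) : ℝ) : ℂ) +
      ((-(2 * (x + R * Real.cos θ) * (R * Real.sin θ)) / (4 * t) : ℝ) : ℂ) * Complex.I := by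
    rw [circleMap, Complex.exp_mul_I]
    push_cast
    have := Complex.I_sq
    linear_combination (-(R * Complex.sin θ) ^ 2 / (4 * (t:ℂ))) * this
  rw [e, Complex.add_re, Complex.re_ofReal_mul, Complex.I_re, Complex.ofReal_re, mul_zero, add_zero]
  have hc := Real.sin_sq_add_cos_sq θ
  have e2 : n * (Real.cos θ + x / (2 * R)) ^ 2 = (R * Real.cos θ + x / 2) ^ 2 / (2 * t) := by
    have : (n : ℝ) = R ^ 2 / (2 * t) := by rw [hR2]; field_simp
    rw [this]; field_simp
  have e3 : (n : ℝ) / 2 = R ^ 2 / (4 * t) := by rw [hR2]; field_simp; ring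
  rw [e2, e3, mul_pow R (Real.sin θ), show Real.sin θ ^ 2 = 1 - Real.cos θ ^ 2 by linarith]
  field_simp
  ring

lemma gdbG_bound2 (t y : ℝ) (ht : 0 < t) (n : ℕ) (hn : n ≠ 0) :
    |gdbG t n y| ≤ 2 * √(n.factorial) * (√(2 * t))⁻¹ ^ n * Real.exp (-y ^ 2 / (8 * t)) := by
  have hn' : (0:ℝ) < n := by positivity
  set R := √(2 * t) * √n with hR
  have hR0 : 0 < R := by positivity
  have hd : Differentiable ℂ (gdbF t) := (gdbF_contDiff t).differentiable (by simp)
  have hps := (hd.hasFPowerSeriesOnBall (y:ℂ) (R := ⟨R, hR0.le⟩) hR0).factorial_smul 1 n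
  rw [iteratedFDeriv_apply_eq_iteratedDeriv_mul_prod, Finset.prod_const_one, one_smul] at hps
  have h1 : |gdbG t n y| ≤ n.factorial * ‖cauchyPowerSeries (gdbF t) y R n‖ := by
    refine (Complex.abs_re_le_norm _).trans ?_
    rw [← hps, nsmul_eq_mul, norm_mul, Complex.norm_natCast]
    refine mul_le_mul_of_nonneg_left ?_ (by positivity)
    refine (ContinuousMultilinearMap.le_opNorm _ _).trans ?_
    simp only [norm_one, Finset.prod_const_one, mul_one]
    exact le_rfl
  have h2 := norm_cauchyPowerSeries_le (gdbF t) y R n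
  simp_rw [hR, gdbF_norm t y _ n hn ht, ← hR] at h2
  rw [intervalIntegral.integral_const_mul, abs_of_pos hR0] at h2
  have h3 := gdb_const n hn (y / (2 * R))
  refine h1.trans ((mul_le_mul_of_nonneg_left h2 (by positivity)).trans ?_)
  have h4 := mul_le_mul_of_nonneg_left h3
    (by positivity : 0 ≤ (√(2 * t))⁻¹ ^ n * Real.exp (-y ^ 2 / (8 * t)))
  refine le_trans (le_of_eq ?_) (h4.trans (le_of_eq ?_))
  · rw [show R⁻¹ ^ n = (√(2 * t))⁻¹ ^ n * (√n)⁻¹ ^ n by rw [hR, mul_inv, mul_pow]]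
    ring
  · ring

def gdbc (n : ℕ) : ℝ := if n ≤ 1 then 1 else 2

def gdbB (n : ℕ) : ℝ := gdbc n * √(n.factorial)

lemma gdbG_bound (t y : ℝ) (ht : 0 < t) (n : ℕ) :
    |gdbG t n y| ≤ gdbB n * (√(2 * t))⁻¹ ^ n * Real.exp (-y ^ 2 / (8 * t)) := by
  unfold gdbB gdbc
  split_ifs with h
  · interval_cases n
    · rw [gdbG_zero, abs_of_pos (Real.exp_pos _)]
      simp only [Nat.factorial_zero, Nat.cast_one, Real.sqrt_one, pow_zero, one_mul]
      apply Real.exp_le_exp.2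
      rw [neg_div, neg_div, neg_le_neg_iff]
      apply div_le_div_of_nonneg_left (by positivity) (by positivity) (by linarith)
    · rw [gdbG_one, abs_mul, abs_of_pos (Real.exp_pos _), abs_neg]
      simp only [Nat.factorial_one, Nat.cast_one, Real.sqrt_one, pow_one, one_mul]
      set q := √(2 * t) with hq
      have hq0 : 0 < q := by positivity
      have hq2 : q ^ 2 = 2 * t := Real.sq_sqrt (by positivity)
      have e1 : Real.exp (-y ^ 2 / (4 * t)) =
          Real.exp (-y ^ 2 / (8 * t)) * Real.exp (-y ^ 2 / (8 * t)) := by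
        rw [← Real.exp_add]; congr 1; field_simp; ring
      rw [e1, ← mul_assoc]
      gcongr
      have e2 : -y ^ 2 / (8 * t) = -((|y| / q) ^ 2 / 4) := by
        rw [div_pow, sq_abs, hq2]; field_simp; ring
      have e3 : |y / (2 * t)| = q⁻¹ * (|y| / q) := by
        rw [abs_div, abs_of_pos (by positivity : 0 < 2 * t), ← hq2]; field_simp
      rw [e2, e3, mul_assoc, Real.exp_neg]
      have h5 : |y| / q ≤ Real.exp ((|y| / q) ^ 2 / 4) := by
        have := Real.add_one_le_exp ((|y| / q) ^ 2 / 4)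
        nlinarith [sq_nonneg (|y| / q - 2)]
      have : |y| / q * (Real.exp ((|y| / q) ^ 2 / 4))⁻¹ ≤ 1 := by
        rw [← div_eq_mul_inv, div_le_one (Real.exp_pos _)]; exact h5
      calc _ ≤ q⁻¹ * 1 := by gcongr
        _ = _ := mul_one _
  · exact gdbG_bound2 t y ht n (by omega)

lemma gdbB_pos (n : ℕ) : 0 < gdbB n := by
  unfold gdbB gdbc; split_ifs <;> positivity

lemma gdbB_mul (a b : ℕ) : gdbB a * gdbB b ≤ gdbB (a + b) := by
  have key : ∀ a b : ℕ, a ≤ b → gdbB a * gdbB b ≤ gdbB (a + b) := by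
    intro a b hab
    have hle : (a.factorial * b.factorial : ℝ) ≤ (a + b).factorial := by
      exact_mod_cast Nat.le_of_dvd (Nat.factorial_pos _) (Nat.factorial_mul_factorial_dvd_factorial_add a b)
    have hs : √(a.factorial) * √(b.factorial) ≤ √((a + b).factorial) := by
      rw [← Real.sqrt_mul (by positivity)]
      exact Real.sqrt_le_sqrt hle
    by_cases ha : a ≤ 1
    · have hc : gdbc b ≤ gdbc (a + b) := by
        unfold gdbc; split_ifs <;> first | omega | norm_num
      have hc0 : 0 ≤ gdbc (a + b) := by unfold gdbc; split_ifs <;> norm_num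
      have e : gdbc a = 1 := if_pos ha
      unfold gdbB
      rw [e]
      calc _ = gdbc b * (√(a.factorial) * √(b.factorial)) := by ring
        _ ≤ _ := by gcongr
    · have e1 : gdbc a = 2 := if_neg ha
      have e2 : gdbc b = 2 := if_neg (by omega)
      have e3 : gdbc (a + b) = 2 := if_neg (by omega)
      unfold gdbB
      rw [e1, e2, e3]
      have h4 : 4 ≤ (a + b).choose a := by
        have h1 : (2 + 2).choose 2 ≤ (a + b).choose 2 := Nat.choose_le_choose 2 (by omega)
        have h2 : (a + b).choose 2 ≤ (a + b).choose a := by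
          have : ∀ k, 2 ≤ k → k ≤ b → (k ≤ (a+b)/2) → (a + b).choose 2 ≤ (a + b).choose k := by
            intro k hk
            induction k, hk using Nat.le_induction with
            | base => intros; exact le_rfl
            | succ k hk ih =>
              intro h1 h2
              exact (ih (by omega) (by omega)).trans (Nat.choose_le_succ_of_lt_half_left (by omega))
          exact this a (by omega) hab (by omega)
        have h3 : (2 + 2).choose 2 = 6 := by decide
        omega
      have h5 : (4 * (a.factorial * b.factorial) : ℝ) ≤ (a + b).factorial := by
        have := Nat.add_choose_mul_factorial_mul_factorial a b
        have h6 : 4 * (a.factorial * b.factorial) ≤ (a + b).factorial := by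
          rw [← this, mul_assoc]; rw [Nat.choose_symm_add] at h4; gcongr
        exact_mod_cast h6
      have h7 : 2 * (√(a.factorial) * √(b.factorial)) ≤ √((a + b).factorial) := by
        rw [← Real.sqrt_mul (by positivity)]
        apply Real.le_sqrt_of_sq_le
        rw [mul_pow, Real.sq_sqrt (by positivity)]
        linarith
      linarith
  rcases le_total a b with h | h
  · exact key a b h
  · rw [mul_comm, add_comm]; exact key b a h

lemma gdbB_prod (s : Finset (Fin 4)) (u : Fin 4 → ℕ) :
    ∏ i ∈ s, gdbB (u i) ≤ gdbB (∑ i ∈ s, u i) := by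
  induction s using Finset.induction_on with
  | empty => simp [gdbB, gdbc]
  | insert a s ha ih =>
    rw [Finset.prod_insert ha, Finset.sum_insert ha]
    exact (mul_le_mul_of_nonneg_left ih (gdbB_pos _).le).trans (gdbB_mul _ _)

def gdbP (t : ℝ) (k : Fin 4 → ℕ) (x : E4) : ℝ := ∏ i, gdbG t (k i) (x i)

lemma gdbP_pderiv (t : ℝ) (k : Fin 4 → ℕ) (j : Fin 4) :
    pderiv4 j (gdbP t k) = gdbP t (k + Pi.single j 1) := by
  ext x
  have hi : ∀ i ∈ (Finset.univ : Finset (Fin 4)), HasFDerivAt (fun y : E4 => gdbG t (k i) (y i))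
      (gdbG t (k i + 1) (x i) • (EuclideanSpace.proj i : E4 →L[ℝ] ℝ)) x := by
    intro i _
    exact (gdbG_hasDerivAt t (k i) (x i)).comp_hasFDerivAt x
      (EuclideanSpace.proj i : E4 →L[ℝ] ℝ).hasFDerivAt
  have h := HasFDerivAt.finsetProd hi
  unfold pderiv4
  have e : gdbP t k = fun y : E4 => ∏ i, gdbG t (k i) (y i) := rfl
  rw [e, h.fderiv]
  rw [_root_.sum_apply, Finset.sum_eq_single j]
  · rw [gdbP, ← Finset.mul_prod_erase _ _ (Finset.mem_univ j)]
    have e2 : ∏ i ∈ Finset.univ.erase j, gdbG t ((k + Pi.single j 1 : Fin 4 → ℕ) i) (x i) =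
        ∏ i ∈ Finset.univ.erase j, gdbG t (k i) (x i) := by
      apply Finset.prod_congr rfl
      intro i hi
      simp [Finset.ne_of_mem_erase hi]
    rw [e2]
    simp [mul_comm]
  · intro i _ hij
    simp [hij]
  · simp

lemma gdbP_iter (t : ℝ) (k : Fin 4 → ℕ) (j : Fin 4) (m : ℕ) :
    (pderiv4 j)^[m] (gdbP t k) = gdbP t (k + Pi.single j m) := by
  induction m with
  | zero => simp
  | succ m ih =>
    rw [Function.iterate_succ_apply', ih, gdbP_pderiv, add_assoc, ← Pi.single_add]

lemma gdbP_mderiv (t : ℝ) (u : Fin 4 → ℕ) : mderiv4 u (gdbP t 0) = gdbP t u := by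
  unfold mderiv4
  have : List.finRange 4 = [0, 1, 2, 3] := by decide
  rw [this]
  simp only [List.foldr, gdbP_iter]
  congr 1
  ext i
  fin_cases i <;> simp

lemma gdbP_zero (t : ℝ) : (fun y : E4 => Real.exp (-‖y‖ ^ 2 / (4 * t))) = gdbP t 0 := by
  ext y
  simp only [gdbP, Pi.zero_apply, gdbG_zero]
  rw [← Real.exp_sum, EuclideanSpace.real_norm_sq_eq, ← Finset.sum_div, Finset.sum_neg_distrib]

/-- Gaussian derivative estimate:
`|∂^u exp(−|x|²/(4t))| ≤ 2·t^{−|u|/2}·√(|u|!)·2^{−|u|/2}·exp(−|x|²/(8t))`. -/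
theorem gaussian_deriv_bound (t : ℝ) (ht : 0 < t) (u : Fin 4 → ℕ) (x : E4) :
    |mderiv4 u (fun y : E4 => Real.exp (-‖y‖ ^ 2 / (4 * t))) x| ≤
      2 * t ^ (-(((∑ i, u i : ℕ) : ℝ)) / 2) * Real.sqrt ((∑ i, u i).factorial) *
        (2 : ℝ) ^ (-(((∑ i, u i : ℕ) : ℝ)) / 2) * Real.exp (-‖x‖ ^ 2 / (8 * t)) := by
  rw [gdbP_zero, gdbP_mderiv, gdbP, Finset.abs_prod]
  have h1 : ∏ i, |gdbG t (u i) (x i)| ≤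
      ∏ i, (gdbB (u i) * (√(2 * t))⁻¹ ^ (u i) * Real.exp (-(x i) ^ 2 / (8 * t))) :=
    Finset.prod_le_prod (fun _ _ => abs_nonneg _) (fun i _ => gdbG_bound t (x i) ht (u i))
  rw [Finset.prod_mul_distrib, Finset.prod_mul_distrib, Finset.prod_pow_eq_pow_sum,
    ← Real.exp_sum, ← Finset.sum_div, Finset.sum_neg_distrib,
    ← EuclideanSpace.real_norm_sq_eq] at h1
  have h2 := gdbB_prod Finset.univ u
  generalize ∑ i, u i = N at *
  have h3 : gdbB N ≤ 2 * √(N.factorial) := by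
    unfold gdbB gdbc
    gcongr
    split_ifs <;> norm_num
  have h4 : (√(2 * t))⁻¹ ^ N = t ^ (-(N:ℝ) / 2) * (2:ℝ) ^ (-(N:ℝ) / 2) := by
    rw [← Real.mul_rpow ht.le (by norm_num), mul_comm t 2, Real.sqrt_eq_rpow,
      ← Real.rpow_neg (by positivity), ← Real.rpow_natCast, ← Real.rpow_mul (by positivity)]
    congr 1; ring
  refine h1.trans ?_
  rw [h4]
  calc _ ≤ (2 * √(N.factorial)) * (t ^ (-(N:ℝ) / 2) * (2:ℝ) ^ (-(N:ℝ) / 2)) *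
        Real.exp (-‖x‖ ^ 2 / (8 * t)) := by
        gcongr
        exact h2.trans h3
    _ = _ := by ring

end
end
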